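/- Let L be a second-order Lagrangian (with no explicit dependence on the spacetime point x) and let Φ : ℝ⁴ → ℝᵏ be a smooth field satisfying the Euler–Lagrange equations E_a(x) = 0 for all a and all x ∈ ℝ⁴. Define the canonical energy-momentum complex T^μ_σ(x) := δ^μ_σ Λ(x) − ∑_a (L_a^μ − ∑_ν ∂_ν L_a^{μν}) ∂_σ Φ_a(x) − ∑_{a,ν} L_a^{μν} ∂_ν ∂_σ Φ_a(x). Then for every σ ∈ Fin 4, ∑_μ ∂_μ T^μ_σ(x) = 0 for all x ∈ ℝ⁴. -/

import Mathlib

noncomputable section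

/-- Partial derivative `∂_μ` of a real-valued function on `ℝ⁴ = Fin 4 → ℝ`. -/
def pd (μ : Fin 4) (f : (Fin 4 → ℝ) → ℝ) (x : Fin 4 → ℝ) : ℝ :=
  fderiv ℝ f x (Pi.single μ 1)

/-- A second-order Lagrangian: a function of `(u, p, q)` where `u ∈ ℝᵏ`,
`p ∈ (Fin 4 → ℝᵏ)` (first derivatives) and `q ∈ (Fin 4 → Fin 4 → ℝᵏ)` (second derivatives). -/
abbrev Lag (k : ℕ) :=
  (Fin k → ℝ) → (Fin 4 → Fin k → ℝ) → (Fin 4 → Fin 4 → Fin k → ℝ) → ℝ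

/-- First-order part of the 2-jet of a field: `∂_μ Φ_a (x)`. -/
def jet1 {k : ℕ} (Φ : (Fin 4 → ℝ) → Fin k → ℝ) (x : Fin 4 → ℝ) : Fin 4 → Fin k → ℝ :=
  fun μ a => pd μ (fun y => Φ y a) x

/-- Second-order part of the 2-jet of a field: `∂_μ ∂_ν Φ_a (x)`. -/
def jet2 {k : ℕ} (Φ : (Fin 4 → ℝ) → Fin k → ℝ) (x : Fin 4 → ℝ) : Fin 4 → Fin 4 → Fin k → ℝ :=
  fun μ ν a => pd μ (fun y => pd ν (fun z => Φ z a) y) x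

/-- `L_a = ∂L/∂u_a`. -/
def Lu {k : ℕ} (L : Lag k) (a : Fin k) (u : Fin k → ℝ) (p : Fin 4 → Fin k → ℝ)
    (q : Fin 4 → Fin 4 → Fin k → ℝ) : ℝ :=
  fderiv ℝ (fun v => L v p q) u (Pi.single a 1)

/-- `L_a^μ = ∂L/∂p_{aμ}`. -/
def Lp {k : ℕ} (L : Lag k) (a : Fin k) (μ : Fin 4) (u : Fin k → ℝ) (p : Fin 4 → Fin k → ℝ)
    (q : Fin 4 → Fin 4 → Fin k → ℝ) : ℝ :=
  fderiv ℝ (fun w => L u w q) p (Pi.single μ (Pi.single a 1))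

/-- `L_a^{μν} = ∂L/∂q_{aμν}`. -/
def Lq {k : ℕ} (L : Lag k) (a : Fin k) (μ ν : Fin 4) (u : Fin k → ℝ) (p : Fin 4 → Fin k → ℝ)
    (q : Fin 4 → Fin 4 → Fin k → ℝ) : ℝ :=
  fderiv ℝ (fun w => L u p w) q (Pi.single μ (Pi.single ν (Pi.single a 1)))

/-- `L_a` evaluated at the 2-jet of `Φ` at `x`. -/
def LuΦ {k : ℕ} (L : Lag k) (Φ : (Fin 4 → ℝ) → Fin k → ℝ) (a : Fin k) (x : Fin 4 → ℝ) : ℝ :=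
  Lu L a (Φ x) (jet1 Φ x) (jet2 Φ x)

/-- `L_a^μ` evaluated at the 2-jet of `Φ` at `x`. -/
def LpΦ {k : ℕ} (L : Lag k) (Φ : (Fin 4 → ℝ) → Fin k → ℝ) (a : Fin k) (μ : Fin 4)
    (x : Fin 4 → ℝ) : ℝ :=
  Lp L a μ (Φ x) (jet1 Φ x) (jet2 Φ x)

/-- `L_a^{μν}` evaluated at the 2-jet of `Φ` at `x`. -/
def LqΦ {k : ℕ} (L : Lag k) (Φ : (Fin 4 → ℝ) → Fin k → ℝ) (a : Fin k) (μ ν : Fin 4)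
    (x : Fin 4 → ℝ) : ℝ :=
  Lq L a μ ν (Φ x) (jet1 Φ x) (jet2 Φ x)

/-- The Lagrangian density `Λ(x)`: `L` evaluated at the 2-jet of `Φ` at `x`. -/
def Lval {k : ℕ} (L : Lag k) (Φ : (Fin 4 → ℝ) → Fin k → ℝ) (x : Fin 4 → ℝ) : ℝ :=
  L (Φ x) (jet1 Φ x) (jet2 Φ x)

/-- The Euler–Lagrange expression `E_a = L_a - ∑_μ ∂_μ L_a^μ + ∑_{μ,ν} ∂_μ ∂_ν L_a^{μν}`. -/
def EL {k : ℕ} (L : Lag k) (Φ : (Fin 4 → ℝ) → Fin k → ℝ) (a : Fin k) (x : Fin 4 → ℝ) : ℝ :=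
  LuΦ L Φ a x - ∑ μ, pd μ (LpΦ L Φ a μ) x
    + ∑ μ, ∑ ν, pd μ (fun y => pd ν (LqΦ L Φ a μ ν) y) x

/-- The canonical energy-momentum complex
`T^μ_σ = δ^μ_σ Λ - ∑_a (L_a^μ - ∑_ν ∂_ν L_a^{μν}) ∂_σ Φ_a - ∑_{a,ν} L_a^{μν} ∂_ν ∂_σ Φ_a`. -/
def EMcomplex {k : ℕ} (L : Lag k) (Φ : (Fin 4 → ℝ) → Fin k → ℝ) (μ σ : Fin 4)
    (x : Fin 4 → ℝ) : ℝ :=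
  (if μ = σ then Lval L Φ x else 0)
    - ∑ a, (LpΦ L Φ a μ x - ∑ ν, pd ν (LqΦ L Φ a μ ν) x) * jet1 Φ x σ a
    - ∑ a, ∑ ν, LqΦ L Φ a μ ν x * jet2 Φ x ν σ a

/-- The space of 2-jets `(u, p, q)`. -/
abbrev JetSpace (k : ℕ) :=
  (Fin k → ℝ) × (Fin 4 → Fin k → ℝ) × (Fin 4 → Fin 4 → Fin k → ℝ)

/-- A Lagrangian as a function on the jet space. -/
def Lag.uncurried {k : ℕ} (L : Lag k) (z : JetSpace k) : ℝ :=
  L z.1 z.2.1 z.2.2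

/-- The 2-jet of a field. -/
def jet {k : ℕ} (Φ : (Fin 4 → ℝ) → Fin k → ℝ) (x : Fin 4 → ℝ) : JetSpace k :=
  (Φ x, jet1 Φ x, jet2 Φ x)

section PartialDerivative

variable {f g : (Fin 4 → ℝ) → ℝ} {x : Fin 4 → ℝ}

theorem contDiff_pd (hf : ContDiff ℝ (⊤ : ℕ∞) f) (μ : Fin 4) :
    ContDiff ℝ (⊤ : ℕ∞) (pd μ f) :=
  (hf.fderiv_right (m := (⊤ : ℕ∞)) le_rfl).clm_apply contDiff_const

theorem pd_comm (hf : ContDiff ℝ (⊤ : ℕ∞) f) (μ ν : Fin 4) (x : Fin 4 → ℝ) :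
    pd μ (pd ν f) x = pd ν (pd μ f) x := by
  have hd : DifferentiableAt ℝ (fderiv ℝ f) x :=
    (hf.fderiv_right (m := (⊤ : ℕ∞)) le_rfl).differentiable (by simp) x
  have key (α β : Fin 4) : pd α (pd β f) x =
      fderiv ℝ (fderiv ℝ f) x (Pi.single α 1) (Pi.single β 1) := by
    change fderiv ℝ (fun y => fderiv ℝ f y (Pi.single β 1)) x (Pi.single α 1) = _
    rw [fderiv_clm_apply hd (differentiableAt_const _)]
    simp
  rw [key, key]
  exact hf.contDiffAt.isSymmSndFDerivAt
    (by simpa using WithTop.coe_le_coe.2 (le_top : (2 : ℕ∞) ≤ ⊤)) _ _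

theorem pd_sub (hf : DifferentiableAt ℝ f x) (hg : DifferentiableAt ℝ g x) (μ : Fin 4) :
    pd μ (fun y => f y - g y) x = pd μ f x - pd μ g x := by
  simp [pd, fderiv_fun_sub hf hg]

theorem pd_mul (hf : DifferentiableAt ℝ f x) (hg : DifferentiableAt ℝ g x) (μ : Fin 4) :
    pd μ (fun y => f y * g y) x = pd μ f x * g x + f x * pd μ g x := by
  simp [pd, fderiv_fun_mul hf hg]
  ring

theorem pd_sum {ι : Type*} {s : Finset ι} {F : ι → (Fin 4 → ℝ) → ℝ}
    (hF : ∀ i ∈ s, DifferentiableAt ℝ (F i) x) (μ : Fin 4) :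
    pd μ (fun y => ∑ i ∈ s, F i y) x = ∑ i ∈ s, pd μ (F i) x := by
  simp [pd, fderiv_fun_sum hF]

end PartialDerivative

section JetSmoothness

variable {k : ℕ} {L : Lag k} {Φ : (Fin 4 → ℝ) → Fin k → ℝ}

theorem contDiff_jet1 (hΦ : ContDiff ℝ (⊤ : ℕ∞) Φ) (μ : Fin 4) (a : Fin k) :
    ContDiff ℝ (⊤ : ℕ∞) (fun x => jet1 Φ x μ a) :=
  contDiff_pd (contDiff_pi.1 hΦ a) μ

theorem contDiff_jet2 (hΦ : ContDiff ℝ (⊤ : ℕ∞) Φ) (μ ν : Fin 4) (a : Fin k) :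
    ContDiff ℝ (⊤ : ℕ∞) (fun x => jet2 Φ x μ ν a) :=
  contDiff_pd (contDiff_jet1 hΦ ν a) μ

theorem contDiff_jet (hΦ : ContDiff ℝ (⊤ : ℕ∞) Φ) : ContDiff ℝ (⊤ : ℕ∞) (jet Φ) :=
  hΦ.prodMk <| ContDiff.prodMk
    (contDiff_pi.2 fun μ => contDiff_pi.2 fun a => contDiff_jet1 hΦ μ a)
    (contDiff_pi.2 fun μ => contDiff_pi.2 fun ν => contDiff_pi.2 fun a => contDiff_jet2 hΦ μ ν a)

theorem Lu_eq_fderiv (hL : ContDiff ℝ (⊤ : ℕ∞) L.uncurried) (a : Fin k) (z : JetSpace k) :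
    Lu L a z.1 z.2.1 z.2.2 = fderiv ℝ L.uncurried z (Pi.single a 1, 0, 0) := by
  have h : HasFDerivAt (fun v => L v z.2.1 z.2.2) _ z.1 :=
    (hL.differentiable (by simp) z).hasFDerivAt.comp (f := fun v => (v, z.2)) z.1
      (hasFDerivAt_prodMk_left z.1 z.2)
  rw [Lu, h.fderiv]
  rfl

theorem Lp_eq_fderiv (hL : ContDiff ℝ (⊤ : ℕ∞) L.uncurried) (a : Fin k) (μ : Fin 4)
    (z : JetSpace k) :
    Lp L a μ z.1 z.2.1 z.2.2 =
      fderiv ℝ L.uncurried z (0, Pi.single μ (Pi.single a 1), 0) := by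
  have h : HasFDerivAt (fun w => L z.1 w z.2.2) _ z.2.1 :=
    (hL.differentiable (by simp) z).hasFDerivAt.comp (f := fun w => (z.1, w, z.2.2)) z.2.1
      ((hasFDerivAt_prodMk_right z.1 z.2).comp (f := fun w => (w, z.2.2)) z.2.1
        (hasFDerivAt_prodMk_left z.2.1 z.2.2))
  rw [Lp, h.fderiv]
  rfl

theorem Lq_eq_fderiv (hL : ContDiff ℝ (⊤ : ℕ∞) L.uncurried) (a : Fin k) (μ ν : Fin 4)
    (z : JetSpace k) :
    Lq L a μ ν z.1 z.2.1 z.2.2 =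
      fderiv ℝ L.uncurried z (0, 0, Pi.single μ (Pi.single ν (Pi.single a 1))) := by
  have h : HasFDerivAt (fun w => L z.1 z.2.1 w) _ z.2.2 :=
    (hL.differentiable (by simp) z).hasFDerivAt.comp (f := fun w => (z.1, z.2.1, w)) z.2.2
      ((hasFDerivAt_prodMk_right z.1 z.2).comp (f := fun w => (z.2.1, w)) z.2.2
        (hasFDerivAt_prodMk_right z.2.1 z.2.2))
  rw [Lq, h.fderiv]
  rfl

theorem contDiff_fderiv_jet (hL : ContDiff ℝ (⊤ : ℕ∞) L.uncurried)
    (hΦ : ContDiff ℝ (⊤ : ℕ∞) Φ) (w : JetSpace k) :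
    ContDiff ℝ (⊤ : ℕ∞) (fun x => fderiv ℝ L.uncurried (jet Φ x) w) :=
  ((hL.fderiv_right (m := (⊤ : ℕ∞)) le_rfl).comp (contDiff_jet hΦ)).clm_apply contDiff_const

theorem contDiff_LpΦ (hL : ContDiff ℝ (⊤ : ℕ∞) L.uncurried) (hΦ : ContDiff ℝ (⊤ : ℕ∞) Φ)
    (a : Fin k) (μ : Fin 4) : ContDiff ℝ (⊤ : ℕ∞) (LpΦ L Φ a μ) :=
  (funext fun x => Lp_eq_fderiv hL a μ (jet Φ x) : LpΦ L Φ a μ = _) ▸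
    contDiff_fderiv_jet hL hΦ _

theorem contDiff_LqΦ (hL : ContDiff ℝ (⊤ : ℕ∞) L.uncurried) (hΦ : ContDiff ℝ (⊤ : ℕ∞) Φ)
    (a : Fin k) (μ ν : Fin 4) : ContDiff ℝ (⊤ : ℕ∞) (LqΦ L Φ a μ ν) :=
  (funext fun x => Lq_eq_fderiv hL a μ ν (jet Φ x) : LqΦ L Φ a μ ν = _) ▸
    contDiff_fderiv_jet hL hΦ _

theorem contDiff_Lval (hL : ContDiff ℝ (⊤ : ℕ∞) L.uncurried) (hΦ : ContDiff ℝ (⊤ : ℕ∞) Φ) :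
    ContDiff ℝ (⊤ : ℕ∞) (Lval L Φ) :=
  hL.comp (contDiff_jet hΦ)

theorem JetSpace.eq_sum_single (w : JetSpace k) :
    w = ∑ a, w.1 a • ((Pi.single a 1, 0, 0) : JetSpace k)
      + ∑ a, ∑ μ, w.2.1 μ a • ((0, Pi.single μ (Pi.single a 1), 0) : JetSpace k)
      + ∑ a, ∑ μ, ∑ ν, w.2.2 μ ν a •
          ((0, 0, Pi.single μ (Pi.single ν (Pi.single a 1))) : JetSpace k) := by
  refine Prod.ext ?_ (Prod.ext ?_ ?_)
  · ext b
    simp [Prod.fst_sum, Finset.sum_apply, Pi.single_apply]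
  · ext α b
    simp [Prod.fst_sum, Prod.snd_sum, Finset.sum_apply, Pi.single_apply]
  · ext α β b
    simp [Prod.snd_sum, Finset.sum_apply, Pi.single_apply]

/-- The derivative of the 2-jet of `Φ` in the direction `σ`. -/
theorem fderiv_jet_single (hΦ : ContDiff ℝ (⊤ : ℕ∞) Φ) (σ : Fin 4) (x : Fin 4 → ℝ) :
    fderiv ℝ (jet Φ) x (Pi.single σ 1) =
      (fun a => jet1 Φ x σ a, fun μ a => jet2 Φ x σ μ a,
        fun μ ν a => pd σ (fun y => jet2 Φ y μ ν a) x) := by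
  have h := ((contDiff_jet hΦ).differentiable (by simp) x).hasFDerivAt
  have h2 := h.snd
  refine Prod.ext ?_ (Prod.ext ?_ ?_)
  · ext a
    exact (congrArg (· (Pi.single σ 1)) (hasFDerivAt_pi'.1 h.fst a).fderiv).symm
  · ext μ a
    exact (congrArg (· (Pi.single σ 1))
      (hasFDerivAt_pi'.1 (hasFDerivAt_pi'.1 h2.fst μ) a).fderiv).symm
  · ext μ ν a
    exact (congrArg (· (Pi.single σ 1))
      (hasFDerivAt_pi'.1 (hasFDerivAt_pi'.1 (hasFDerivAt_pi'.1 h2.snd μ) ν) a).fderiv).symm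

/-- The chain rule for the Lagrangian density. -/
theorem pd_Lval (hL : ContDiff ℝ (⊤ : ℕ∞) L.uncurried) (hΦ : ContDiff ℝ (⊤ : ℕ∞) Φ)
    (σ : Fin 4) (x : Fin 4 → ℝ) :
    pd σ (Lval L Φ) x = ∑ a, LuΦ L Φ a x * jet1 Φ x σ a
      + ∑ a, ∑ μ, LpΦ L Φ a μ x * jet2 Φ x σ μ a
      + ∑ a, ∑ μ, ∑ ν, LqΦ L Φ a μ ν x * pd σ (fun y => jet2 Φ y μ ν a) x := by
  have h : HasFDerivAt (Lval L Φ) _ x :=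
    (hL.differentiable (by simp) (jet Φ x)).hasFDerivAt.comp x
      ((contDiff_jet hΦ).differentiable (by simp) x).hasFDerivAt
  have hu (a) : LuΦ L Φ a x = _ := Lu_eq_fderiv hL a (jet Φ x)
  have hp (a μ) : LpΦ L Φ a μ x = _ := Lp_eq_fderiv hL a μ (jet Φ x)
  have hq (a μ ν) : LqΦ L Φ a μ ν x = _ := Lq_eq_fderiv hL a μ ν (jet Φ x)
  rw [pd, h.fderiv, ContinuousLinearMap.comp_apply, fderiv_jet_single hΦ,
    JetSpace.eq_sum_single (_, _, _)]
  simp only [map_add, map_sum, map_smul, smul_eq_mul, hu, hp, hq, mul_comm]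

theorem pd_jet2_comm (hΦ : ContDiff ℝ (⊤ : ℕ∞) Φ) (μ ν σ : Fin 4) (a : Fin k)
    (x : Fin 4 → ℝ) :
    pd σ (fun y => jet2 Φ y μ ν a) x = pd μ (fun y => jet2 Φ y ν σ a) x := by
  have h : (fun y => jet2 Φ y ν σ a) = fun y => jet2 Φ y σ ν a :=
    funext fun y => pd_comm (contDiff_pi.1 hΦ a) ν σ y
  rw [h]
  exact pd_comm (contDiff_jet1 hΦ ν a) σ μ x

theorem pd_EMcomplex (hL : ContDiff ℝ (⊤ : ℕ∞) L.uncurried) (hΦ : ContDiff ℝ (⊤ : ℕ∞) Φ)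
    (μ σ : Fin 4) (x : Fin 4 → ℝ) :
    pd μ (EMcomplex L Φ μ σ) x = (if μ = σ then pd σ (Lval L Φ) x else 0)
      - ∑ a, ((pd μ (LpΦ L Φ a μ) x - ∑ ν, pd μ (pd ν (LqΦ L Φ a μ ν)) x) * jet1 Φ x σ a
        + (LpΦ L Φ a μ x - ∑ ν, pd ν (LqΦ L Φ a μ ν) x) * jet2 Φ x μ σ a)
      - ∑ a, ∑ ν, (pd μ (LqΦ L Φ a μ ν) x * jet2 Φ x ν σ a
        + LqΦ L Φ a μ ν x * pd μ (fun y => jet2 Φ y ν σ a) x) := by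
  have hd {f : (Fin 4 → ℝ) → ℝ} (hf : ContDiff ℝ (⊤ : ℕ∞) f) : DifferentiableAt ℝ f x :=
    hf.differentiable (by simp) x
  have hp (a) := contDiff_LpΦ hL hΦ a μ
  have hq (a ν) := contDiff_LqΦ hL hΦ a μ ν
  have hdq (a ν) := contDiff_pd (hq a ν) ν
  have h1 (a) := contDiff_jet1 hΦ σ a
  have h2 (a ν) := contDiff_jet2 hΦ ν σ a
  have hsum (a) : ContDiff ℝ (⊤ : ℕ∞) (fun y => ∑ ν, pd ν (LqΦ L Φ a μ ν) y) :=
    ContDiff.sum fun ν _ => hdq a ν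
  have hP (a) := (hp a).sub (hsum a)
  have hPj (a) := (hP a).mul (h1 a)
  have hQj (a ν) := (hq a ν).mul (h2 a ν)
  have hQs (a) := ContDiff.sum (s := Finset.univ) fun ν _ => hQj a ν
  have hδ : ContDiff ℝ (⊤ : ℕ∞) (fun y => if μ = σ then Lval L Φ y else 0) := by
    split_ifs
    exacts [contDiff_Lval hL hΦ, contDiff_const]
  have hA := ContDiff.sum (s := Finset.univ) fun a _ => hPj a
  have hB := ContDiff.sum (s := Finset.univ) fun a _ => hQs a
  unfold EMcomplex
  rw [pd_sub (hd (hδ.sub hA)) (hd hB), pd_sub (hd hδ) (hd hA),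
    pd_sum fun a _ => hd (hPj a), pd_sum fun a _ => hd (hQs a)]
  congr 2
  · split_ifs with h
    · rw [h]
    · simp [pd]
  · refine Finset.sum_congr rfl fun a _ => ?_
    rw [pd_mul (hd (hP a)) (hd (h1 a)), pd_sub (hd (hp a)) (hd (hsum a)),
      pd_sum fun ν _ => hd (hdq a ν)]
    rfl
  · funext a
    rw [pd_sum fun ν _ => hd (hQj a ν)]
    exact Finset.sum_congr rfl fun ν _ => pd_mul (hd (hq a ν)) (hd (h2 a ν)) μ

end JetSmoothness

/-- **Conservation of the canonical energy-momentum complex** (eqn (31) of the paper):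
for a solution `Φ` of the Euler–Lagrange equations of a second-order Lagrangian with no
explicit dependence on the spacetime point, `∑_μ ∂_μ T^μ_σ = 0` for each `σ`. -/
theorem canonical_energy_momentum_conservation
    (k : ℕ) (L : Lag k)
    (hL : ContDiff ℝ (⊤ : ℕ∞) (fun z : (Fin k → ℝ) × (Fin 4 → Fin k → ℝ) × (Fin 4 → Fin 4 → Fin k → ℝ) =>
      L z.1 z.2.1 z.2.2))
    (hLsym : ∀ (a : Fin k) (μ ν : Fin 4) (u : Fin k → ℝ) (p : Fin 4 → Fin k → ℝ)
      (q : Fin 4 → Fin 4 → Fin k → ℝ), Lq L a μ ν u p q = Lq L a ν μ u p q)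
    (Φ : (Fin 4 → ℝ) → Fin k → ℝ) (hΦ : ContDiff ℝ (⊤ : ℕ∞) Φ)
    (hEL : ∀ (a : Fin k) (x : Fin 4 → ℝ), EL L Φ a x = 0) :
    ∀ (σ : Fin 4) (x : Fin 4 → ℝ),
      ∑ μ, pd μ (fun y => EMcomplex L Φ μ σ y) x = 0 := by
  intro σ x
  have hLsymΦ (a μ ν) : LqΦ L Φ a μ ν = LqΦ L Φ a ν μ := funext fun y => hLsym a μ ν _ _ _
  have hcross (a) : ∑ μ, ∑ ν, pd ν (LqΦ L Φ a μ ν) x * jet2 Φ x μ σ a =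
      ∑ μ, ∑ ν, pd μ (LqΦ L Φ a μ ν) x * jet2 Φ x ν σ a := by
    rw [Finset.sum_comm]
    simp_rw [fun μ ν => hLsymΦ a ν μ]
  have hj (a μ) : jet2 Φ x σ μ a = jet2 Φ x μ σ a := pd_comm (contDiff_pi.1 hΦ a) σ μ x
  have hEL' (a) : LuΦ L Φ a x = ∑ μ, pd μ (LpΦ L Φ a μ) x
      - ∑ μ, ∑ ν, pd μ (pd ν (LqΦ L Φ a μ ν)) x := by
    have h := hEL a x
    unfold EL at h
    linarith
  rw [Finset.sum_congr rfl fun μ _ => pd_EMcomplex hL hΦ μ σ x]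
  have hswap (F : Fin 4 → Fin k → ℝ) : ∑ μ, ∑ a, F μ a = ∑ a, ∑ μ, F μ a := Finset.sum_comm
  rw [Finset.sum_sub_distrib, Finset.sum_sub_distrib, hswap, hswap, Finset.sum_ite_eq',
    if_pos (Finset.mem_univ _), pd_Lval hL hΦ]
  simp only [pd_jet2_comm hΦ _ _ σ, hj]
  rw [← Finset.sum_add_distrib, ← Finset.sum_add_distrib, ← Finset.sum_sub_distrib,
    ← Finset.sum_sub_distrib]
  refine Finset.sum_eq_zero fun a _ => ?_
  have hc := hcross a
  simp only [hEL', sub_mul, Finset.sum_mul, Finset.sum_add_distrib,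
    Finset.sum_sub_distrib] at hc ⊢
  linarith

end
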